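/- Let ⪰ be a total well-founded ordering on a set T and >_R a well-founded ordering on a ring R. Define an ordering on finitely supported functions F = {f : T → R with finite support} by: f ≻ g iff HM(f) ≻ HM(g), or HM(f) = HM(g) and RED(f) ≻ RED(g), where HM(f) is the monomial of f at the ⪰-largest element of supp(f), RED(f) = f − HM(f), and monomials are compared by m_{t₁} ≻ m_{t₂} iff t₁ ≻ t₂ or (t₁ = t₂ and m_{t₁}(t₁) >_R m_{t₂}(t₂)), with f ≻ 0 for all nonzero f. Then this ordering ≻ on F is well-founded. -/

import Mathlib

variable {T R : Type*} [LinearOrder T] [Nonempty T] [Ring R]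

/-- The head term of a finitely supported function: the largest element of its
support (junk value if the function is zero). -/
noncomputable def HT (f : T →₀ R) : T :=
  if h : f.support.Nonempty then f.support.max' h else Classical.arbitrary T

/-- The head coefficient. -/
noncomputable def HC (f : T →₀ R) : R := f (HT f)

/-- The head monomial. -/
noncomputable def HM (f : T →₀ R) : T →₀ R := Finsupp.single (HT f) (HC f)

/-- The head term as an element of `WithBot T` (`⊥` for the zero function). -/
def HTb (f : T →₀ R) : WithBot T := f.support.max

/-- The ordering `≻` on finitely supported functions induced by the total
well-founded ordering on `T` and the well-founded ordering `gtR` on `R`: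
`f ≻ g` iff `HM f ≻ HM g` (monomials compared first by head term, then by
coefficient via `gtR`), or `HM f = HM g` and `RED f ≻ RED g`; moreover
`f ≻ 0` for all nonzero `f`. -/
inductive FGT (gtR : R → R → Prop) : (T →₀ R) → (T →₀ R) → Prop where
  | zero {f : T →₀ R} : f ≠ 0 → FGT gtR f 0
  | term {f g : T →₀ R} : g ≠ 0 → HTb g < HTb f → FGT gtR f g
  | coeff {f g : T →₀ R} : f ≠ 0 → g ≠ 0 → HT f = HT g → gtR (HC f) (HC g) → FGT gtR f g
  | red {f g : T →₀ R} : HM f = HM g → FGT gtR (f - HM f) (g - HM g) → FGT gtR f g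

/-- Auxiliary relation on coefficients (zero is made the least element). -/
def auxRel (gtR : R → R → Prop) (a b : R) : Prop :=
  b ≠ 0 ∧ (a = 0 ∨ (a ≠ 0 ∧ gtR b a))

theorem HT_max {f : T →₀ R} (hf : f ≠ 0) :
    f (HT f) ≠ 0 ∧ (∀ d, HT f < d → f d = 0) ∧ HTb f = ((HT f : T) : WithBot T) := by
  have h : f.support.Nonempty := Finsupp.support_nonempty_iff.mpr hf
  have e : HT f = f.support.max' h := by simp [HT, h]
  refine ⟨?_, ?_, ?_⟩
  · rw [e]
    exact Finsupp.mem_support_iff.mp (f.support.max'_mem h)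
  · intro d hd
    by_contra hne
    rw [e] at hd
    exact absurd (f.support.le_max' d (Finsupp.mem_support_iff.mpr hne)) (not_le.mpr hd)
  · rw [e, HTb, Finset.coe_max']

theorem FGT_lex (gtR : R → R → Prop) {f g : T →₀ R} (h : FGT gtR f g) :
    ∃ j, (∀ d, j < d → g d = f d) ∧ auxRel gtR (g j) (f j) := by
  induction h with
  | @zero f hf =>
    obtain ⟨h1, h2, -⟩ := HT_max hf
    exact ⟨HT f, fun d hd => by simp [h2 d hd], h1, Or.inl rfl⟩
  | @term f g hg hlt =>
    have hf : f ≠ 0 := by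
      rintro rfl
      simp [HTb] at hlt
    obtain ⟨h1, h2, h3⟩ := HT_max hf
    obtain ⟨g1, g2, g3⟩ := HT_max hg
    rw [h3, g3, WithBot.coe_lt_coe] at hlt
    exact ⟨HT f, fun d hd => by rw [h2 d hd, g2 d (hlt.trans hd)], h1, Or.inl (g2 _ hlt)⟩
  | @coeff f g hf hg he hc =>
    obtain ⟨h1, h2, h3⟩ := HT_max hf
    obtain ⟨g1, g2, g3⟩ := HT_max hg
    unfold HC at hc
    rw [← he] at hc g1 g2
    exact ⟨HT f, fun d hd => by rw [h2 d hd, g2 d hd], h1, Or.inr ⟨g1, hc⟩⟩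
  | @red f g he _ ih =>
    obtain ⟨j, hj, hr⟩ := ih
    refine ⟨j, fun d hd => ?_, ?_⟩
    · have := hj d hd
      rw [he] at this
      simpa using this
    · by_cases hz : HM f j = 0
      · have hz' : HM g j = 0 := he ▸ hz
        simpa [hz, hz'] using hr
      · exfalso
        have hjf : j = HT f := by
          by_contra hne
          exact hz (by simp [HM, Ne.symm hne])
        apply hr.1
        subst hjf
        simp [HM, HC]

theorem auxRel_wf (gtR : R → R → Prop)
    (hR : ¬ ∃ c : ℕ → R, ∀ n, gtR (c n) (c (n + 1))) : WellFounded (auxRel gtR) := by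
  have hw : WellFounded (fun a b => gtR b a) := by
    rw [wellFounded_iff_isEmpty_descending_chain]
    exact ⟨fun c => hR ⟨c.1, c.2⟩⟩
  have h0 : Acc (auxRel gtR) 0 := ⟨_, fun y hy => absurd rfl hy.1⟩
  refine ⟨fun a => ?_⟩
  induction a using hw.induction with
  | _ a ih =>
    refine ⟨_, fun y hy => ?_⟩
    rcases hy.2 with rfl | ⟨-, h⟩
    · exact h0
    · exact ih y h

/-- The induced ordering `≻` on finitely supported functions is well-founded,
i.e. admits no infinite strictly descending chains. -/
theorem FGT_wellFounded (gtR : R → R → Prop)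
    (hT : ¬ ∃ c : ℕ → T, ∀ n, c (n + 1) < c n)
    (hR : ¬ ∃ c : ℕ → R, ∀ n, gtR (c n) (c (n + 1))) :
    ¬ ∃ c : ℕ → (T →₀ R), ∀ n, FGT gtR (c n) (c (n + 1)) := by
  rintro ⟨c, hc⟩
  have hw : WellFounded (fun a b : T => a < b) := by
    rw [wellFounded_iff_isEmpty_descending_chain]
    exact ⟨fun c => hT ⟨c.1, c.2⟩⟩
  have hl : WellFounded (Finsupp.Lex (fun a b : T => b < a) (auxRel gtR)) :=
    Finsupp.Lex.wellFounded' (fun n h => h.1 rfl) (auxRel_wf gtR hR) hw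
  rw [wellFounded_iff_isEmpty_descending_chain] at hl
  exact hl.false ⟨c, fun n => FGT_lex gtR (hc n)⟩
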